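/- (Accelerated RSD, convex case.) Under the accelerated RSD setting — A x^0 = b, v^0 = x^0, M symmetric positive semidefinite and positive definite on ker(A), f differentiable and convex with f(y) ≤ f(x) + ⟨∇f(x), y−x⟩ + ½(y−x)^T M(y−x) on x^0 + ker(A), S^k i.i.d. from a finite distribution with Z = Σ_i P_i Z_{S_i} positive definite on ker(A), ν ≥ ν_max := max{ (Σ_i P_i u^T Z_{S_i} Z† Z_{S_i} u)/(u^T Z u) : 0 ≠ u ∈ ker(A) } — choose γ_0 = 1/ν, γ_{k+1} = (1/ν + √(1/ν² + 4γ_k²))/2, α_k = 1/(γ_k ν), and iterate y^k = α_k v^k + (1−α_k) x^k, x^{k+1} = y^k − Z_{S^k} ∇f(y^k), v^{k+1} = v^k − γ_k Z_{S^k} ∇f(y^k). Then for every k ≥ 1, E[ f(x^k) − f* ] ≤ (2ν/(k+1)²) · min_{x* ∈ X*} (x^0 − x*)^T Z† (x^0 − x*), where f* is the minimum of f over {x : Ax = b} and X* the set of minimizers. -/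

import Mathlib

open Matrix

-- The Moore–Penrose pseudoinverse of a real matrix, defined via the four
-- Penrose conditions (which have a unique solution for every real matrix).
open Classical in
noncomputable def mpinv {k l : Type*} [Fintype k] [Fintype l] (B : Matrix k l ℝ) :
    Matrix l k ℝ :=
  if h : ∃ X : Matrix l k ℝ,
      B * X * B = B ∧ X * B * X = X ∧ (B * X)ᵀ = B * X ∧ (X * B)ᵀ = X * B
  then h.choose else 0

/-- `P_S = I - (AS)†(AS)`, the orthogonal projection onto `ker(AS)`. -/
noncomputable def Pmat {m n p : ℕ} (A : Matrix (Fin m) (Fin n) ℝ)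
    (S : Matrix (Fin n) (Fin p) ℝ) : Matrix (Fin p) (Fin p) ℝ :=
  1 - mpinv (A * S) * (A * S)

/-- `Z_S = S P_S (P_Sᵀ Sᵀ M S P_S)† P_Sᵀ Sᵀ`. -/
noncomputable def Zmat {m n p : ℕ} (A : Matrix (Fin m) (Fin n) ℝ)
    (M : Matrix (Fin n) (Fin n) ℝ) (S : Matrix (Fin n) (Fin p) ℝ) :
    Matrix (Fin n) (Fin n) ℝ :=
  S * Pmat A S * mpinv ((Pmat A S)ᵀ * Sᵀ * M * S * Pmat A S) * (Pmat A S)ᵀ * Sᵀ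

/-- The gradient of `f : ℝ^n → ℝ`, as a vector of partial derivatives. -/
noncomputable def gradv {n : ℕ} (f : (Fin n → ℝ) → ℝ) (x : Fin n → ℝ) : Fin n → ℝ :=
  fun i => fderiv ℝ f x (Pi.single i 1)

/-- The four Penrose conditions: `X` is the Moore–Penrose pseudoinverse of `B`. -/
structure IsPenroseInverse {k l : Type*} [Fintype k] [Fintype l] (B : Matrix k l ℝ)
    (X : Matrix l k ℝ) : Prop where
  mul_mul_self : B * X * B = B
  self_mul_mul : X * B * X = X
  transpose_mul_right : (B * X)ᵀ = B * X
  transpose_mul_left : (X * B)ᵀ = X * B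

namespace IsPenroseInverse

variable {k l : Type*} [Fintype k] [Fintype l]

theorem unique {B : Matrix k l ℝ} {X Y : Matrix l k ℝ} (hX : IsPenroseInverse B X)
    (hY : IsPenroseInverse B Y) : X = Y := by
  have h1 : B * X = B * Y := by
    calc B * X = (B * X)ᵀ := hX.transpose_mul_right.symm
      _ = ((B * Y) * (B * X))ᵀ := by rw [← Matrix.mul_assoc, hY.mul_mul_self]
      _ = (B * X) * (B * Y) := by
        rw [Matrix.transpose_mul, hX.transpose_mul_right, hY.transpose_mul_right]
      _ = B * Y := by rw [← Matrix.mul_assoc, hX.mul_mul_self]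
  have h2 : X * B = Y * B := by
    calc X * B = (X * B)ᵀ := hX.transpose_mul_left.symm
      _ = ((X * B) * (Y * B))ᵀ := by
        rw [Matrix.mul_assoc X B, ← Matrix.mul_assoc B Y B, hY.mul_mul_self]
      _ = (Y * B) * (X * B) := by
        rw [Matrix.transpose_mul, hX.transpose_mul_left, hY.transpose_mul_left]
      _ = Y * B := by rw [Matrix.mul_assoc Y B, ← Matrix.mul_assoc B X B, hX.mul_mul_self]
  rw [← hX.self_mul_mul, Matrix.mul_assoc, h1, ← Matrix.mul_assoc, h2, hY.self_mul_mul]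

theorem transpose {B : Matrix k l ℝ} {X : Matrix l k ℝ} (h : IsPenroseInverse B X) :
    IsPenroseInverse Bᵀ Xᵀ where
  mul_mul_self := by
    rw [Matrix.mul_assoc, ← Matrix.transpose_mul, ← Matrix.transpose_mul, h.mul_mul_self]
  self_mul_mul := by
    rw [Matrix.mul_assoc, ← Matrix.transpose_mul, ← Matrix.transpose_mul, h.self_mul_mul]
  transpose_mul_right := by
    rw [← Matrix.transpose_mul, h.transpose_mul_left, h.transpose_mul_left]
  transpose_mul_left := by
    rw [← Matrix.transpose_mul, h.transpose_mul_right, h.transpose_mul_right]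

theorem transpose_eq_of_symm {B X : Matrix k k ℝ} (h : IsPenroseInverse B X) (hB : Bᵀ = B) :
    Xᵀ = X := by
  have ht := h.transpose
  rw [hB] at ht
  exact ht.unique h

theorem exists_of_symm {H : Matrix k k ℝ} (hH : Hᵀ = H) : ∃ X, IsPenroseInverse H X := by
  classical
  have hherm : H.IsHermitian := by
    rw [Matrix.IsHermitian, Matrix.conjTranspose_eq_transpose_of_trivial, hH]
  obtain ⟨U, d, hU, hd⟩ : ∃ (U : Matrix k k ℝ) (d : k → ℝ), Uᵀ * U = 1 ∧
      H = U * Matrix.diagonal d * Uᵀ := by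
    refine ⟨hherm.eigenvectorUnitary, hherm.eigenvalues, ?_, ?_⟩
    · have := Unitary.coe_star_mul_self hherm.eigenvectorUnitary
      rwa [Matrix.star_eq_conjTranspose, Matrix.conjTranspose_eq_transpose_of_trivial] at this
    · have := hherm.spectral_theorem
      rw [Unitary.conjStarAlgAut_apply, Matrix.star_eq_conjTranspose,
        Matrix.conjTranspose_eq_transpose_of_trivial] at this
      exact this
  have key : ∀ a c : k → ℝ, (U * Matrix.diagonal a * Uᵀ) * (U * Matrix.diagonal c * Uᵀ) =
      U * Matrix.diagonal (fun i => a i * c i) * Uᵀ := by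
    intro a c
    calc _ = U * Matrix.diagonal a * (Uᵀ * U) * Matrix.diagonal c * Uᵀ := by
          simp only [Matrix.mul_assoc]
      _ = _ := by
          rw [hU, Matrix.mul_one, Matrix.mul_assoc U, Matrix.diagonal_mul_diagonal]
  have keyT : ∀ a : k → ℝ, (U * Matrix.diagonal a * Uᵀ)ᵀ = U * Matrix.diagonal a * Uᵀ := by
    intro a
    simp [Matrix.transpose_mul, Matrix.mul_assoc]
  refine ⟨U * Matrix.diagonal (fun i => (d i)⁻¹) * Uᵀ, ?_, ?_, ?_, ?_⟩
  · rw [hd, key, key]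
    congr 3
    funext i
    exact mul_inv_mul_cancel (d i)
  · rw [hd, key, key]
    congr 3
    funext i
    simpa using mul_inv_mul_cancel (d i)⁻¹
  · rw [hd, key, keyT]
  · rw [hd, key, keyT]

theorem exists_inverse (B : Matrix k l ℝ) : ∃ X, IsPenroseInverse B X := by
  classical
  have hsymm : (Bᵀ * B)ᵀ = Bᵀ * B := by simp
  obtain ⟨G, hG⟩ := exists_of_symm hsymm
  have hGT : Gᵀ = G := hG.transpose_eq_of_symm hsymm
  have h1 : B * (G * Bᵀ) * B = B := by
    have h0 : (B * (G * Bᵀ) * B - B)ᵀ * (B * (G * Bᵀ) * B - B) = 0 := by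
      have e1 : Bᵀ * (B * (G * Bᵀ) * B) = Bᵀ * B := by
        calc _ = (Bᵀ * B) * G * (Bᵀ * B) := by simp only [Matrix.mul_assoc]
          _ = _ := hG.mul_mul_self
      have e2 : Bᵀ * (B * (G * Bᵀ) * B - B) = 0 := by rw [Matrix.mul_sub, e1, sub_self]
      have e3 : (B * (G * Bᵀ) * B - B)ᵀ = (Bᵀ * B * G - 1 : Matrix l l ℝ) * Bᵀ := by
        simp [Matrix.transpose_mul, hGT, Matrix.sub_mul, Matrix.mul_assoc]
      rw [e3, Matrix.mul_assoc, e2, Matrix.mul_zero]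
    rw [← Matrix.conjTranspose_eq_transpose_of_trivial,
      Matrix.conjTranspose_mul_self_eq_zero] at h0
    exact sub_eq_zero.mp h0
  refine ⟨G * Bᵀ, h1, ?_, ?_, ?_⟩
  · calc _ = (G * (Bᵀ * B) * G) * Bᵀ := by simp only [Matrix.mul_assoc]
      _ = _ := by rw [hG.self_mul_mul]
  · simp [Matrix.transpose_mul, hGT, Matrix.mul_assoc]
  · rw [Matrix.mul_assoc]
    exact hG.transpose_mul_left

end IsPenroseInverse

theorem isPenroseInverse_mpinv {k l : Type*} [Fintype k] [Fintype l] (B : Matrix k l ℝ) :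
    IsPenroseInverse B (mpinv B) := by
  have h : ∃ X : Matrix l k ℝ,
      B * X * B = B ∧ X * B * X = X ∧ (B * X)ᵀ = B * X ∧ (X * B)ᵀ = X * B := by
    obtain ⟨X, hX⟩ := IsPenroseInverse.exists_inverse B
    exact ⟨X, hX.1, hX.2, hX.3, hX.4⟩
  rw [mpinv, dif_pos h]
  obtain ⟨h1, h2, h3, h4⟩ := h.choose_spec
  exact ⟨h1, h2, h3, h4⟩

section Zmat

variable {m n p : ℕ} (A : Matrix (Fin m) (Fin n) ℝ) (M : Matrix (Fin n) (Fin n) ℝ)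
  (S : Matrix (Fin n) (Fin p) ℝ)

theorem transpose_Zmat (hM : Mᵀ = M) : (Zmat A M S)ᵀ = Zmat A M S := by
  have hK := (isPenroseInverse_mpinv ((Pmat A S)ᵀ * Sᵀ * M * S * Pmat A S)).transpose_eq_of_symm
    (by simp [Matrix.transpose_mul, hM, Matrix.mul_assoc])
  rw [Zmat]
  simp only [Matrix.transpose_mul, hK, Matrix.transpose_transpose]
  simp only [Matrix.mul_assoc]

theorem mul_Zmat : A * Zmat A M S = 0 := by
  have h : A * S * Pmat A S = 0 := by
    rw [Pmat, Matrix.mul_sub, Matrix.mul_one, ← Matrix.mul_assoc,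
      (isPenroseInverse_mpinv (A * S)).mul_mul_self, sub_self]
  rw [Zmat]
  simp only [← Matrix.mul_assoc]
  simp [h]

theorem Zmat_mul_mul_Zmat : Zmat A M S * M * Zmat A M S = Zmat A M S := by
  have h := (isPenroseInverse_mpinv ((Pmat A S)ᵀ * Sᵀ * M * S * Pmat A S)).self_mul_mul
  rw [Zmat]
  set K := mpinv ((Pmat A S)ᵀ * Sᵀ * M * S * Pmat A S)
  calc _ = S * Pmat A S * (K * ((Pmat A S)ᵀ * Sᵀ * M * S * Pmat A S) * K) * (Pmat A S)ᵀ * Sᵀ := by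
        simp only [Matrix.mul_assoc]
    _ = _ := by rw [h]

end Zmat

theorem mulVec_dotProduct_of_symm {k : Type*} [Fintype k] {B : Matrix k k ℝ} (hB : Bᵀ = B)
    (u w : k → ℝ) : B.mulVec u ⬝ᵥ w = u ⬝ᵥ B.mulVec w := by
  rw [Matrix.dotProduct_mulVec, ← Matrix.mulVec_transpose, hB]

section SymmetricPseudoinverse

variable {m n : ℕ} {A : Matrix (Fin m) (Fin n) ℝ} {Z : Matrix (Fin n) (Fin n) ℝ}

theorem mpinv_dotProduct_nonneg (hZT : Zᵀ = Z) (hZ0 : ∀ u, 0 ≤ u ⬝ᵥ Z.mulVec u)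
    (u : Fin n → ℝ) : 0 ≤ u ⬝ᵥ (mpinv Z).mulVec u := by
  have hp := isPenroseInverse_mpinv Z
  have h := hZ0 ((mpinv Z).mulVec u)
  rwa [mulVec_dotProduct_of_symm (hp.transpose_eq_of_symm hZT), Matrix.mulVec_mulVec,
    Matrix.mulVec_mulVec, hp.self_mul_mul] at h

theorem mul_mpinv_comm_of_symm (hZT : Zᵀ = Z) : Z * mpinv Z = mpinv Z * Z := by
  have hp := isPenroseInverse_mpinv Z
  rw [← hp.transpose_mul_right, Matrix.transpose_mul, hZT, hp.transpose_eq_of_symm hZT]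

/-- If a symmetric `Z` has range in `ker A` and is positive definite there, then `Z Z†` fixes
`ker A`. -/
theorem mul_mpinv_mulVec_of_mem_ker (hZT : Zᵀ = Z) (hAZ : A * Z = 0)
    (hpd : ∀ u : Fin n → ℝ, A.mulVec u = 0 → u ≠ 0 → 0 < u ⬝ᵥ Z.mulVec u)
    {w : Fin n → ℝ} (hw : A.mulVec w = 0) : Z.mulVec ((mpinv Z).mulVec w) = w := by
  have hp := isPenroseInverse_mpinv Z
  by_contra hne
  have hker : A.mulVec (w - Z.mulVec ((mpinv Z).mulVec w)) = 0 := by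
    rw [Matrix.mulVec_sub, hw, Matrix.mulVec_mulVec, hAZ, Matrix.zero_mulVec, sub_zero]
  have hpos := hpd _ hker (sub_ne_zero.mpr (Ne.symm hne))
  have hz : Z.mulVec (w - Z.mulVec ((mpinv Z).mulVec w)) = 0 := by
    rw [Matrix.mulVec_sub, Matrix.mulVec_mulVec w, mul_mpinv_comm_of_symm hZT,
      Matrix.mulVec_mulVec, ← Matrix.mul_assoc, hp.mul_mul_self, sub_self]
  rw [hz, dotProduct_zero] at hpos
  exact lt_irrefl _ hpos

/-- A vector may be replaced by its projection `Z Z† g` before applying a symmetric matrix whose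
range lies in `ker A`. -/
theorem mulVec_mul_mpinv_mulVec (hZT : Zᵀ = Z) (hAZ : A * Z = 0)
    (hpd : ∀ u : Fin n → ℝ, A.mulVec u = 0 → u ≠ 0 → 0 < u ⬝ᵥ Z.mulVec u)
    {W : Matrix (Fin n) (Fin n) ℝ} (hWT : Wᵀ = W) (hAW : A * W = 0) (g : Fin n → ℝ) :
    W.mulVec (Z.mulVec ((mpinv Z).mulVec g)) = W.mulVec g := by
  have hp := isPenroseInverse_mpinv Z
  refine dotProduct_eq _ _ fun u => ?_
  have hWu : A.mulVec (W.mulVec u) = 0 := by rw [Matrix.mulVec_mulVec, hAW, Matrix.zero_mulVec]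
  have hfix := mul_mpinv_mulVec_of_mem_ker hZT hAZ hpd hWu
  rw [Matrix.mulVec_mulVec, mul_mpinv_comm_of_symm hZT, ← Matrix.mulVec_mulVec] at hfix
  rw [mulVec_dotProduct_of_symm hWT, mulVec_dotProduct_of_symm hZT,
    mulVec_dotProduct_of_symm (hp.transpose_eq_of_symm hZT), hfix, mulVec_dotProduct_of_symm hWT]

end SymmetricPseudoinverse

theorem gradv_dotProduct {n : ℕ} (f : (Fin n → ℝ) → ℝ) (x d : Fin n → ℝ) :
    gradv f x ⬝ᵥ d = fderiv ℝ f x d := by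
  conv_rhs => rw [← Finset.univ_sum_single d]
  rw [map_sum, dotProduct]
  refine Finset.sum_congr rfl fun i _ => ?_
  have : (Pi.single i (d i) : Fin n → ℝ) = d i • Pi.single i 1 := by
    rw [← Pi.single_smul, smul_eq_mul, mul_one]
  rw [this, map_smul, smul_eq_mul, mul_comm, gradv]

theorem ConvexOn.add_gradv_dotProduct_le {n : ℕ} {f : (Fin n → ℝ) → ℝ}
    (hconv : ConvexOn ℝ Set.univ f) (hdiff : Differentiable ℝ f) (x y : Fin n → ℝ) :
    f x + gradv f x ⬝ᵥ (y - x) ≤ f y := by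
  have hcl : ConvexOn ℝ Set.univ (f ∘ (AffineMap.lineMap x y : ℝ →ᵃ[ℝ] (Fin n → ℝ))) := by
    simpa using hconv.comp_affineMap (AffineMap.lineMap x y : ℝ →ᵃ[ℝ] (Fin n → ℝ))
  have hd : HasDerivAt (f ∘ (AffineMap.lineMap x y : ℝ →ᵃ[ℝ] (Fin n → ℝ)))
      (fderiv ℝ f x (y - x)) 0 := by
    have h1 : HasFDerivAt f (fderiv ℝ f x) ((AffineMap.lineMap x y : ℝ →ᵃ[ℝ] (Fin n → ℝ)) 0) := by
      rw [AffineMap.lineMap_apply_zero]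
      exact (hdiff x).hasFDerivAt
    exact h1.comp_hasDerivAt 0 AffineMap.hasDerivAt_lineMap
  have h := hcl.le_slope_of_hasDerivAt (Set.mem_univ 0) (Set.mem_univ 1) one_pos hd
  rw [gradv_dotProduct]
  simp only [slope_def_field, Function.comp_apply, AffineMap.lineMap_apply_one,
    AffineMap.lineMap_apply_zero, sub_zero, div_one] at h
  linarith

theorem dotProduct_sum_smul_mulVec {ι k : Type*} [Fintype ι] [Fintype k] (P : ι → ℝ)
    (W : ι → Matrix k k ℝ) (u g : k → ℝ) :
    u ⬝ᵥ (∑ i, P i • W i).mulVec g = ∑ i, P i * (u ⬝ᵥ (W i).mulVec g) := by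
  rw [Matrix.sum_mulVec, dotProduct_sum]
  exact Finset.sum_congr rfl fun i _ => by
    rw [Matrix.smul_mulVec, dotProduct_smul, smul_eq_mul]

/-- Expectation over `k + 1` samples, conditioning on the first `k`. -/
theorem sum_prod_mul_snoc {N k : ℕ} (P : Fin N → ℝ) (F : (Fin (k + 1) → Fin N) → ℝ) :
    ∑ ω, (∏ j, P (ω j)) * F ω =
      ∑ ω : Fin k → Fin N, (∏ j, P (ω j)) *
        ∑ i, P i * F (Fin.snoc (α := fun _ => Fin N) ω i) := by
  rw [← (Fin.snocEquiv fun _ : Fin (k + 1) => Fin N).sum_comp, Fintype.sum_prod_type_right]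
  refine Finset.sum_congr rfl fun ω _ => ?_
  rw [Finset.mul_sum]
  refine Finset.sum_congr rfl fun i _ => ?_
  rw [Fin.prod_univ_castSucc]
  simp [Fin.snocEquiv, mul_assoc]

/-- One-step decrease of the accelerated randomized descent potential in expectation over the
current sample. -/
theorem accelerated_step {m n N : ℕ} {A : Matrix (Fin m) (Fin n) ℝ} {b : Fin m → ℝ}
    {M : Matrix (Fin n) (Fin n) ℝ} {f : (Fin n → ℝ) → ℝ} (hdiff : Differentiable ℝ f)
    (hconv : ConvexOn ℝ Set.univ f)
    (hsmooth : ∀ x y : Fin n → ℝ, A.mulVec x = b → A.mulVec y = b →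
      f y ≤ f x + gradv f x ⬝ᵥ (y - x) + (1 / 2) * ((y - x) ⬝ᵥ M.mulVec (y - x)))
    {W : Fin N → Matrix (Fin n) (Fin n) ℝ} (hWT : ∀ i, (W i)ᵀ = W i) (hAW : ∀ i, A * W i = 0)
    (hWM : ∀ i, W i * M * W i = W i)
    {P : Fin N → ℝ} (hP : ∀ i, 0 ≤ P i) (hPsum : ∑ i, P i = 1)
    {Z : Matrix (Fin n) (Fin n) ℝ} (hZ : Z = ∑ i, P i • W i)
    (hZT : Zᵀ = Z) (hAZ : A * Z = 0)
    (hpd : ∀ u : Fin n → ℝ, A.mulVec u = 0 → u ≠ 0 → 0 < u ⬝ᵥ Z.mulVec u)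
    {ν : ℝ} (hν : ∀ u : Fin n → ℝ, A.mulVec u = 0 → u ≠ 0 →
      (∑ i, P i * ((W i).mulVec u ⬝ᵥ (mpinv Z).mulVec ((W i).mulVec u))) ≤
        ν * (u ⬝ᵥ Z.mulVec u))
    {γ α : ℝ} (hν0 : 0 < ν) (hγ : 1 / ν ≤ γ) (hα : α = 1 / (γ * ν))
    {x v y xs : Fin n → ℝ} (hx : A.mulVec x = b) (hv : A.mulVec v = b)
    (hxs : A.mulVec xs = b) (hy : y = α • v + (1 - α) • x) :
    ∑ i, P i * ((v - γ • (W i).mulVec (gradv f y) - xs) ⬝ᵥ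
        (mpinv Z).mulVec (v - γ • (W i).mulVec (gradv f y) - xs) +
      2 * (γ ^ 2 * ν) * (f (y - (W i).mulVec (gradv f y)) - f xs)) ≤
    (v - xs) ⬝ᵥ (mpinv Z).mulVec (v - xs) + 2 * (γ ^ 2 * ν - γ) * (f x - f xs) := by
  have hγ0 : 0 < γ := lt_of_lt_of_le (by positivity) hγ
  have hγν : 1 ≤ γ * ν := by rwa [div_le_iff₀ hν0] at hγ
  have hAy : A.mulVec y = b := by
    rw [hy, Matrix.mulVec_add, Matrix.mulVec_smul, Matrix.mulVec_smul, hx, hv, ← add_smul]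
    simp
  set g := gradv f y with hg
  have hGT := (isPenroseInverse_mpinv Z).transpose_eq_of_symm hZT
  set G := mpinv Z with hG
  have hdescent : ∀ i, f (y - (W i).mulVec g) ≤ f y - 1 / 2 * (g ⬝ᵥ (W i).mulVec g) := by
    intro i
    have hA : A.mulVec (y - (W i).mulVec g) = b := by
      rw [Matrix.mulVec_sub, Matrix.mulVec_mulVec, hAW, hAy, Matrix.zero_mulVec, sub_zero]
    have h := hsmooth y _ hAy hA
    have e : y - (W i).mulVec g - y = -((W i).mulVec g) := by abel
    rw [e, Matrix.mulVec_neg, neg_dotProduct_neg, dotProduct_neg,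
      mulVec_dotProduct_of_symm (hWT i), Matrix.mulVec_mulVec, Matrix.mulVec_mulVec,
      hWM] at h
    linarith
  have hexpand : ∀ i, (v - γ • (W i).mulVec g - xs) ⬝ᵥ G.mulVec (v - γ • (W i).mulVec g - xs) =
      (v - xs) ⬝ᵥ G.mulVec (v - xs) - 2 * γ * (G.mulVec (v - xs) ⬝ᵥ (W i).mulVec g) +
        γ ^ 2 * ((W i).mulVec g ⬝ᵥ G.mulVec ((W i).mulVec g)) := by
    intro i
    have e : v - γ • (W i).mulVec g - xs = (v - xs) - γ • (W i).mulVec g := by abel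
    rw [e]
    generalize v - xs = w
    simp only [Matrix.mulVec_sub, Matrix.mulVec_smul, sub_dotProduct, dotProduct_sub,
      smul_dotProduct, dotProduct_smul, smul_eq_mul]
    rw [dotProduct_comm ((W i).mulVec g) (G.mulVec w),
      ← mulVec_dotProduct_of_symm hGT w ((W i).mulVec g)]
    ring
  have hcross : G.mulVec (v - xs) ⬝ᵥ Z.mulVec g = g ⬝ᵥ (v - xs) := by
    rw [dotProduct_comm, mulVec_dotProduct_of_symm hZT,
      mul_mpinv_mulVec_of_mem_ker hZT hAZ hpd (by rw [Matrix.mulVec_sub, hv, hxs, sub_self])]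
  have hquad : ∑ i, P i * ((W i).mulVec g ⬝ᵥ G.mulVec ((W i).mulVec g)) ≤
      ν * (g ⬝ᵥ Z.mulVec g) := by
    set u := Z.mulVec (G.mulVec g) with hu
    have hWu : ∀ i, (W i).mulVec u = (W i).mulVec g := fun i =>
      mulVec_mul_mpinv_mulVec hZT hAZ hpd (hWT i) (hAW i) g
    have hZu : Z.mulVec u = Z.mulVec g := mulVec_mul_mpinv_mulVec hZT hAZ hpd hZT hAZ g
    have huu : u ⬝ᵥ Z.mulVec u = g ⬝ᵥ Z.mulVec g := by
      rw [hZu, ← mulVec_dotProduct_of_symm hZT, hZu, mulVec_dotProduct_of_symm hZT]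
    by_cases h0 : u = 0
    · have hW0 : ∀ i, (W i).mulVec g = 0 := fun i => by rw [← hWu, h0, Matrix.mulVec_zero]
      simp only [hW0, zero_dotProduct, mul_zero, Finset.sum_const_zero]
      rw [← huu, h0, zero_dotProduct, mul_zero]
    · have hAu : A.mulVec u = 0 := by
        rw [hu, Matrix.mulVec_mulVec, hAZ, Matrix.zero_mulVec]
      have h := hν u hAu h0
      rw [huu] at h
      simpa only [hWu] using h
  have hupper : ∑ i, P i * ((v - γ • (W i).mulVec g - xs) ⬝ᵥ
        G.mulVec (v - γ • (W i).mulVec g - xs) +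
      2 * (γ ^ 2 * ν) * (f (y - (W i).mulVec g) - f xs)) ≤
      (v - xs) ⬝ᵥ G.mulVec (v - xs) - 2 * γ * (g ⬝ᵥ (v - xs)) +
        2 * (γ ^ 2 * ν) * (f y - f xs) := by
    calc _ ≤ ∑ i, (P i * ((v - xs) ⬝ᵥ G.mulVec (v - xs) + 2 * (γ ^ 2 * ν) * (f y - f xs)) -
          2 * γ * (P i * (G.mulVec (v - xs) ⬝ᵥ (W i).mulVec g)) +
          γ ^ 2 * (P i * ((W i).mulVec g ⬝ᵥ G.mulVec ((W i).mulVec g))) -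
          γ ^ 2 * ν * (P i * (g ⬝ᵥ (W i).mulVec g))) := by
          refine Finset.sum_le_sum fun i _ => ?_
          have h1 : P i * (2 * (γ ^ 2 * ν) * (f (y - (W i).mulVec g) - f xs)) ≤
              P i * (2 * (γ ^ 2 * ν) * (f y - 1 / 2 * (g ⬝ᵥ (W i).mulVec g) - f xs)) := by
            have := hdescent i
            have := hP i
            gcongr
          rw [hexpand]
          linarith
      _ = (v - xs) ⬝ᵥ G.mulVec (v - xs) + 2 * (γ ^ 2 * ν) * (f y - f xs) -
          2 * γ * (g ⬝ᵥ (v - xs)) +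
          γ ^ 2 * ∑ i, P i * ((W i).mulVec g ⬝ᵥ G.mulVec ((W i).mulVec g)) -
          γ ^ 2 * ν * (g ⬝ᵥ Z.mulVec g) := by
          rw [Finset.sum_sub_distrib, Finset.sum_add_distrib, Finset.sum_sub_distrib,
            ← Finset.sum_mul, hPsum, ← Finset.mul_sum, ← Finset.mul_sum, ← Finset.mul_sum,
            ← dotProduct_sum_smul_mulVec, ← dotProduct_sum_smul_mulVec, ← hZ, hcross, one_mul]
      _ ≤ _ := by
          have := mul_le_mul_of_nonneg_left hquad (sq_nonneg γ)
          linarith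
  have hconvs := hconv.add_gradv_dotProduct_le hdiff y xs
  have hconvx := hconv.add_gradv_dotProduct_le hdiff y x
  rw [← hg] at hconvs hconvx
  have hvy : v - xs = (y - xs) + (γ * ν - 1) • (y - x) := by
    have hαγ : γ * ν * α = 1 := by rw [hα]; field_simp
    funext j
    simp only [hy, Pi.sub_apply, Pi.add_apply, Pi.smul_apply, smul_eq_mul]
    linear_combination (x j - v j) * hαγ
  have hlin : f y - f xs + (γ * ν - 1) * (f y - f x) ≤ g ⬝ᵥ (v - xs) := by
    have e1 : g ⬝ᵥ (xs - y) = -(g ⬝ᵥ (y - xs)) := by rw [← dotProduct_neg, neg_sub]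
    have e2 : g ⬝ᵥ (x - y) = -(g ⬝ᵥ (y - x)) := by rw [← dotProduct_neg, neg_sub]
    rw [hvy, dotProduct_add, dotProduct_smul, smul_eq_mul]
    have := mul_le_mul_of_nonneg_left (show f y - f x ≤ g ⬝ᵥ (y - x) by linarith)
      (sub_nonneg.mpr hγν)
    linarith
  have := mul_le_mul_of_nonneg_left hlin hγ0.le
  linarith

section StepSizes

variable {ν : ℝ} {γ : ℕ → ℝ}

theorem half_add_le_stepSize (hν0 : 0 < ν) (hγ0 : γ 0 = 1 / ν)
    (hγs : ∀ k : ℕ, γ (k + 1) = (1 / ν + Real.sqrt (1 / ν ^ 2 + 4 * γ k ^ 2)) / 2) (k : ℕ) :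
    (k + 2) / (2 * ν) ≤ γ k := by
  induction k with
  | zero => rw [hγ0]; apply le_of_eq; push_cast; field_simp; norm_num
  | succ k ih =>
    have h : 2 * γ k ≤ Real.sqrt (1 / ν ^ 2 + 4 * γ k ^ 2) := by
      apply Real.le_sqrt_of_sq_le
      have : 0 ≤ 1 / ν ^ 2 := by positivity
      linarith
    have e : ((k + 1 : ℕ) + 2 : ℝ) / (2 * ν) = (k + 2) / (2 * ν) + 1 / ν / 2 := by
      push_cast; field_simp; ring
    rw [hγs, e]
    linarith

theorem stepSize_succ_sq_mul_sub (hν0 : 0 < ν)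
    (hγs : ∀ k : ℕ, γ (k + 1) = (1 / ν + Real.sqrt (1 / ν ^ 2 + 4 * γ k ^ 2)) / 2) (k : ℕ) :
    γ (k + 1) ^ 2 * ν - γ (k + 1) = γ k ^ 2 * ν := by
  have hs := Real.sq_sqrt (show 0 ≤ 1 / ν ^ 2 + 4 * γ k ^ 2 by positivity)
  rw [hγs]
  set s := Real.sqrt (1 / ν ^ 2 + 4 * γ k ^ 2)
  have e : ((1 / ν + s) / 2) ^ 2 * ν - (1 / ν + s) / 2 = (s ^ 2 - 1 / ν ^ 2) / 4 * ν := by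
    field_simp
    ring
  rw [e, hs]
  ring

end StepSizes

/-- accelerated RSD in the smooth convex case:
`E[f(x^k) − f*] ≤ (2ν/(k+1)²) · min_{x* ∈ X*} ‖x⁰ − x*‖²_{Z†}`. -/
theorem stmt15 {m n N : ℕ} (A : Matrix (Fin m) (Fin n) ℝ) (b : Fin m → ℝ)
    (x0 : Fin n → ℝ) (hx0 : A.mulVec x0 = b)
    (M : Matrix (Fin n) (Fin n) ℝ) (hM : M.PosSemidef)
    (hMpd : ∀ u : Fin n → ℝ, A.mulVec u = 0 → u ≠ 0 → 0 < u ⬝ᵥ M.mulVec u)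
    (f : (Fin n → ℝ) → ℝ) (hdiff : Differentiable ℝ f) (hconv : ConvexOn ℝ Set.univ f)
    (hsmooth : ∀ x y : Fin n → ℝ, A.mulVec x = b → A.mulVec y = b →
      f y ≤ f x + gradv f x ⬝ᵥ (y - x) + (1 / 2) * ((y - x) ⬝ᵥ M.mulVec (y - x)))
    (p : Fin N → ℕ) (S : ∀ i : Fin N, Matrix (Fin n) (Fin (p i)) ℝ)
    (P : Fin N → ℝ) (hP : ∀ i, 0 ≤ P i) (hPsum : ∑ i, P i = 1)
    (Z : Matrix (Fin n) (Fin n) ℝ) (hZ : Z = ∑ i, P i • Zmat A M (S i))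
    (hpd : ∀ u : Fin n → ℝ, A.mulVec u = 0 → u ≠ 0 → 0 < u ⬝ᵥ Z.mulVec u)
    -- `ν ≥ ν_max`
    (ν : ℝ) (hν0 : 0 < ν)
    (hν : ∀ u : Fin n → ℝ, A.mulVec u = 0 → u ≠ 0 →
      (∑ i, P i * ((Zmat A M (S i)).mulVec u ⬝ᵥ
          (mpinv Z).mulVec ((Zmat A M (S i)).mulVec u))) ≤ ν * (u ⬝ᵥ Z.mulVec u))
    -- optimal value, attained
    (fstar : ℝ) (hfs : ∀ x : Fin n → ℝ, A.mulVec x = b → fstar ≤ f x)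
    (hfattained : ∃ xs : Fin n → ℝ, A.mulVec xs = b ∧ f xs = fstar)
    -- the step-size sequences
    (γ α : ℕ → ℝ) (hγ0 : γ 0 = 1 / ν)
    (hγs : ∀ k : ℕ, γ (k + 1) = (1 / ν + Real.sqrt (1 / ν ^ 2 + 4 * γ k ^ 2)) / 2)
    (hα : ∀ k : ℕ, α k = 1 / (γ k * ν))
    -- the A-RSD iterates, indexed by the history of i.i.d. sketch samples
    (X V Y : ∀ k : ℕ, (Fin k → Fin N) → (Fin n → ℝ))
    (hX0 : ∀ ω : Fin 0 → Fin N, X 0 ω = x0) (hV0 : ∀ ω : Fin 0 → Fin N, V 0 ω = x0)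
    (hY : ∀ (k : ℕ) (ω : Fin k → Fin N), Y k ω = α k • V k ω + (1 - α k) • X k ω)
    (hXstep : ∀ (k : ℕ) (ω : Fin (k + 1) → Fin N),
      X (k + 1) ω = Y k (fun j => ω j.castSucc) -
        (Zmat A M (S (ω (Fin.last k)))).mulVec (gradv f (Y k (fun j => ω j.castSucc))))
    (hVstep : ∀ (k : ℕ) (ω : Fin (k + 1) → Fin N),
      V (k + 1) ω = V k (fun j => ω j.castSucc) -
        γ k • (Zmat A M (S (ω (Fin.last k)))).mulVec
          (gradv f (Y k (fun j => ω j.castSucc))))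
    (k : ℕ) (hk : 1 ≤ k) :
    (∑ ω : Fin k → Fin N, (∏ j, P (ω j)) * (f (X k ω) - fstar)) ≤
      2 * ν / (k + 1) ^ 2 *
        sInf {d : ℝ | ∃ xs : Fin n → ℝ, (A.mulVec xs = b ∧ f xs = fstar) ∧
          d = (x0 - xs) ⬝ᵥ (mpinv Z).mulVec (x0 - xs)} := by
  have hMT : Mᵀ = M := by
    rw [← Matrix.conjTranspose_eq_transpose_of_trivial]
    exact hM.isHermitian
  obtain ⟨W, hW⟩ : ∃ W : Fin N → Matrix (Fin n) (Fin n) ℝ, ∀ i, Zmat A M (S i) = W i :=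
    ⟨_, fun _ => rfl⟩
  have hWT : ∀ i, (W i)ᵀ = W i := fun i => hW i ▸ transpose_Zmat A M (S i) hMT
  have hAW : ∀ i, A * W i = 0 := fun i => hW i ▸ mul_Zmat A M (S i)
  have hWM : ∀ i, W i * M * W i = W i := fun i => hW i ▸ Zmat_mul_mul_Zmat A M (S i)
  simp only [hW] at hZ hν hXstep hVstep
  have hZT : Zᵀ = Z := by
    simp only [hZ, Matrix.transpose_sum, Matrix.transpose_smul, hWT]
  have hAZ : A * Z = 0 := by
    simp [hZ, Matrix.mul_sum, hAW]
  have hZ0 : ∀ u, 0 ≤ u ⬝ᵥ Z.mulVec u := by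
    intro u
    rw [hZ, dotProduct_sum_smul_mulVec]
    refine Finset.sum_nonneg fun i _ => mul_nonneg (hP i) ?_
    have h := hM.dotProduct_mulVec_nonneg ((W i).mulVec u)
    rwa [star_trivial, mulVec_dotProduct_of_symm (hWT i), Matrix.mulVec_mulVec,
      Matrix.mulVec_mulVec, hWM] at h
  have hγlb := half_add_le_stepSize hν0 hγ0 hγs
  have hγν : ∀ j, 1 / ν ≤ γ j := by
    intro j
    refine le_trans ?_ (hγlb j)
    rw [div_le_div_iff₀ hν0 (by positivity)]
    have : (0 : ℝ) ≤ j * ν := by positivity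
    linarith
  have hfeas : ∀ (j : ℕ) (ω : Fin j → Fin N), A.mulVec (X j ω) = b ∧ A.mulVec (V j ω) = b := by
    intro j
    induction j with
    | zero => intro ω; rw [hX0, hV0]; exact ⟨hx0, hx0⟩
    | succ j ih =>
      intro ω
      obtain ⟨h1, h2⟩ := ih fun l => ω l.castSucc
      have hAy : A.mulVec (Y j fun l => ω l.castSucc) = b := by
        rw [hY, Matrix.mulVec_add, Matrix.mulVec_smul, Matrix.mulVec_smul, h1, h2, ← add_smul]
        simp
      constructor
      · rw [hXstep, Matrix.mulVec_sub, Matrix.mulVec_mulVec, hAW, hAy, Matrix.zero_mulVec,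
          sub_zero]
      · rw [hVstep, Matrix.mulVec_sub, Matrix.mulVec_smul, Matrix.mulVec_mulVec, hAW, h2,
          Matrix.zero_mulVec, smul_zero, sub_zero]
  have hprod : ∀ (j : ℕ) (ω : Fin j → Fin N), 0 ≤ ∏ l, P (ω l) := fun j ω =>
    Finset.prod_nonneg fun l _ => hP _
  have hbound : ∀ xs, A.mulVec xs = b → f xs = fstar → ∀ j : ℕ,
      ∑ ω : Fin (j + 1) → Fin N, (∏ l, P (ω l)) *
        ((V (j + 1) ω - xs) ⬝ᵥ (mpinv Z).mulVec (V (j + 1) ω - xs) +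
          2 * (γ j ^ 2 * ν) * (f (X (j + 1) ω) - fstar)) ≤
      (x0 - xs) ⬝ᵥ (mpinv Z).mulVec (x0 - xs) := by
    intro xs hxs hfxs
    have hstep : ∀ j : ℕ,
        ∑ ω : Fin (j + 1) → Fin N, (∏ l, P (ω l)) *
          ((V (j + 1) ω - xs) ⬝ᵥ (mpinv Z).mulVec (V (j + 1) ω - xs) +
            2 * (γ j ^ 2 * ν) * (f (X (j + 1) ω) - fstar)) ≤
        ∑ ω : Fin j → Fin N, (∏ l, P (ω l)) *
          ((V j ω - xs) ⬝ᵥ (mpinv Z).mulVec (V j ω - xs) +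
            2 * (γ j ^ 2 * ν - γ j) * (f (X j ω) - fstar)) := by
      intro j
      rw [sum_prod_mul_snoc]
      refine Finset.sum_le_sum fun ω _ => mul_le_mul_of_nonneg_left ?_ (hprod j ω)
      have h := accelerated_step hdiff hconv hsmooth hWT hAW hWM hP hPsum hZ hZT hAZ hpd hν hν0
        (hγν j) (hα j) (hfeas j ω).1 (hfeas j ω).2 hxs (hY j ω)
      rw [hfxs] at h
      simpa only [hXstep, hVstep, Fin.snoc_castSucc, Fin.snoc_last] using h
    intro j
    induction j with
    | zero =>
      refine (hstep 0).trans (le_of_eq ?_)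
      have hz : γ 0 ^ 2 * ν - γ 0 = 0 := by rw [hγ0]; field_simp; ring
      simp [hz, hV0]
    | succ j ih =>
      refine (hstep (j + 1)).trans ?_
      rwa [stepSize_succ_sq_mul_sub hν0 hγs]
  obtain ⟨j, rfl⟩ := Nat.exists_eq_add_of_le' hk
  set E := ∑ ω : Fin (j + 1) → Fin N, (∏ l, P (ω l)) * (f (X (j + 1) ω) - fstar) with hE
  have hE0 : 0 ≤ E := Finset.sum_nonneg fun ω _ =>
    mul_nonneg (hprod _ ω) (sub_nonneg.mpr (hfs _ (hfeas _ ω).1))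
  have hmain : ((j + 1 : ℕ) + 1 : ℝ) ^ 2 / (2 * ν) * E ≤
      sInf {d : ℝ | ∃ xs : Fin n → ℝ, (A.mulVec xs = b ∧ f xs = fstar) ∧
          d = (x0 - xs) ⬝ᵥ (mpinv Z).mulVec (x0 - xs)} := by
    refine le_csInf ?_ ?_
    · obtain ⟨xs, hxs⟩ := hfattained
      exact ⟨_, xs, hxs, rfl⟩
    · rintro d ⟨xs, ⟨hxs, hfxs⟩, rfl⟩
      refine le_trans ?_ (hbound xs hxs hfxs j)
      have hsq : ((j + 1 : ℕ) + 1 : ℝ) ^ 2 / (2 * ν) ≤ 2 * (γ j ^ 2 * ν) := by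
        calc ((j + 1 : ℕ) + 1 : ℝ) ^ 2 / (2 * ν) = 2 * (((j + 2) / (2 * ν)) ^ 2 * ν) := by
              push_cast; field_simp; ring
          _ ≤ _ := by
              have := hγlb j
              gcongr
      calc _ ≤ 2 * (γ j ^ 2 * ν) * E := mul_le_mul_of_nonneg_right hsq hE0
        _ ≤ _ := by
          rw [hE, Finset.mul_sum]
          refine Finset.sum_le_sum fun ω _ => ?_
          have := mul_nonneg (hprod _ ω) (mpinv_dotProduct_nonneg hZT hZ0 (V (j + 1) ω - xs))
          linarith
  have hpos : (0 : ℝ) < ((j + 1 : ℕ) + 1 : ℝ) ^ 2 := by positivity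
  calc E = 2 * ν / ((j + 1 : ℕ) + 1 : ℝ) ^ 2 * (((j + 1 : ℕ) + 1 : ℝ) ^ 2 / (2 * ν) * E) := by
        field_simp
    _ ≤ _ := mul_le_mul_of_nonneg_left hmain (by positivity)
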